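/- arXiv:1304.7274 — 7 statements merged into one kernel-verified Lean document; each statement's English description precedes it below -/
import Mathlib

section
/- Let $m, n$ be positive integers and let $r_1,\dots,r_m$ and $c_1,\dots,c_n$ be non-negative integers with $\sum_{i=1}^m r_i = \sum_{j=1}^n c_j$. Then there exists a unique $m \times n$ matrix $(p_{i,j})$ of non-negative integers which is staircase and satisfies $\sum_{j=1}^n p_{i,j} = r_i$ for all $i = 1,\dots,m$ and $\sum_{i=1}^m p_{i,j} = c_j$ for all $j = 1,\dots,n$. -/
/-- An `m × n` matrix of non-negative integers is staircase if whenever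
`p i j > 0`, `i' < i` and `j < j'`, then `p i' j' = 0`. -/
def IsStaircase {m n : ℕ} (p : Fin m → Fin n → ℕ) : Prop :=
  ∀ i i' : Fin m, ∀ j j' : Fin n, 0 < p i j → i' < i → j < j' → p i' j' = 0

/-- Every family of multiplicities `r` is the family of fibre sizes of a monotone map. -/
theorem exists_monotone_card_fiber {m N : ℕ} (r : Fin m → ℕ) (h : ∑ i, r i = N) :
    ∃ f : Fin N → Fin m, Monotone f ∧ ∀ i, (Finset.univ.filter fun x => f x = i).card = r i := by
  have hc : Fintype.card (Σₗ i : Fin m, Fin (r i)) = N := by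
    rw [← h, ← Fintype.card_congr (toLex (α := Σ i : Fin m, Fin (r i)))]
    simp
  let e := monoEquivOfFin (Σₗ i : Fin m, Fin (r i)) hc
  refine ⟨fun x => (ofLex (e x)).1, fun x y hxy => ?_, fun i => ?_⟩
  · rcases Sigma.Lex.le_def.1 (e.monotone hxy) with hlt | ⟨heq, -⟩
    · exact hlt.le
    · exact heq.le
  · have hcard : Fintype.card {x // (ofLex (e x)).1 = i} = r i :=
      (Fintype.card_congr (((e.toEquiv.trans ofLex).subtypeEquiv
        (q := fun s : Σ i : Fin m, Fin (r i) => s.1 = i) fun _ => Iff.rfl).trans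
          (Equiv.sigmaSubtype i))).trans (Fintype.card_fin _)
    rw [← hcard, Fintype.card_subtype]

/-- If `p` is staircase and agrees with `q` above and to the left of `(i, j)`, and both have the
same sums along row `i` and column `j`, then `q i j ≤ p i j`. -/
theorem IsStaircase.apply_le {m n : ℕ} {p q : Fin m → Fin n → ℕ} (hp : IsStaircase p)
    {i : Fin m} {j : Fin n} (hrow : ∑ j', p i j' = ∑ j', q i j')
    (hcol : ∑ i', p i' j = ∑ i', q i' j)
    (hleft : ∀ j' < j, p i j' = q i j') (habove : ∀ i' < i, p i' j = q i' j) :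
    q i j ≤ p i j := by
  by_contra! hlt
  obtain ⟨j', hj, hj'⟩ : ∃ j', j < j' ∧ 0 < p i j' := by
    by_contra! H
    refine hrow.not_lt (Finset.sum_lt_sum (fun k _ => ?_) ⟨j, Finset.mem_univ _, hlt⟩)
    rcases lt_trichotomy k j with hk | rfl | hk
    · exact (hleft k hk).le
    · exact hlt.le
    · exact (H k hk).trans (Nat.zero_le _)
  obtain ⟨i', hi, hi'⟩ : ∃ i', i < i' ∧ 0 < p i' j := by
    by_contra! H
    refine hcol.not_lt (Finset.sum_lt_sum (fun k _ => ?_) ⟨i, Finset.mem_univ _, hlt⟩)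
    rcases lt_trichotomy k i with hk | rfl | hk
    · exact (habove k hk).le
    · exact hlt.le
    · exact (H k hk).trans (Nat.zero_le _)
  exact hj'.ne' (hp i' i j j' hi' hi hj)

/-- A staircase matrix is determined by its row and column sums. -/
theorem IsStaircase.eq_of_sums_eq {m n : ℕ} {p q : Fin m → Fin n → ℕ} (hp : IsStaircase p)
    (hq : IsStaircase q) (hrow : ∀ i, ∑ j, p i j = ∑ j, q i j)
    (hcol : ∀ j, ∑ i, p i j = ∑ i, q i j) : p = q := by
  have key : ∀ i j, p i j = q i j := by
    intro i
    induction i using WellFoundedLT.induction with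
    | ind i ihi =>
      intro j
      induction j using WellFoundedLT.induction with
      | ind j ihj =>
        exact le_antisymm
          (hq.apply_le (hrow i).symm (hcol j).symm (fun k hk => (ihj k hk).symm)
            fun k hk => (ihi k hk j).symm)
          (hp.apply_le (hrow i) (hcol j) ihj fun k hk => ihi k hk j)
  exact funext fun i => funext (key i)

theorem stmt_2 (m n : ℕ) (hm : 0 < m) (hn : 0 < n)
    (r : Fin m → ℕ) (c : Fin n → ℕ) (h : ∑ i, r i = ∑ j, c j) :
    ∃! p : Fin m → Fin n → ℕ,
      IsStaircase p ∧ (∀ i, ∑ j, p i j = r i) ∧ (∀ j, ∑ i, p i j = c j) := by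
  obtain ⟨f, hf, hfr⟩ := exists_monotone_card_fiber r h
  obtain ⟨g, hg, hgc⟩ := exists_monotone_card_fiber c rfl
  refine existsUnique_of_exists_of_unique
    ⟨fun i j => (Finset.univ.filter fun x => f x = i ∧ g x = j).card, ?_, fun i => ?_,
      fun j => ?_⟩ ?_
  · intro i i' j j' hpos hi hj
    obtain ⟨x, hx⟩ := Finset.card_pos.1 hpos
    obtain ⟨rfl, rfl⟩ := (Finset.mem_filter.1 hx).2
    refine Finset.card_eq_zero.2 (Finset.filter_eq_empty_iff.2 ?_)
    rintro y - ⟨rfl, rfl⟩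
    exact lt_asymm (hf.reflect_lt hi) (hg.reflect_lt hj)
  · rw [← hfr i, Finset.card_eq_sum_card_fiberwise (f := g) (t := Finset.univ) (by simp)]
    simp only [Finset.filter_filter]
  · rw [← hgc j, Finset.card_eq_sum_card_fiberwise (f := f) (t := Finset.univ) (by simp)]
    simp only [Finset.filter_filter, and_comm]
  · rintro p q ⟨hp, hpr, hpc⟩ ⟨hq, hqr, hqc⟩
    exact hp.eq_of_sums_eq hq (fun i => (hpr i).trans (hqr i).symm)
      fun j => (hpc j).trans (hqc j).symm
end

section
/- Let $m, n, q$ be positive integers. The number of staircase $m \times n$ matrices $(p_{i,j})$ of non-negative integers such that $\sum_{i=1}^m p_{i,j} < q$ for every column index $j \in \{1,\dots,n\}$ equals $\sum_{i=1}^{n} (-1)^{n-i}\binom{n}{i}\binom{iq + m - 1}{m+n-1}$. -/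
/-- Binomial coefficient of an integer `t` over a natural `b`, with the
convention that it is `0` whenever `t < b` (in particular whenever `t < 0`). -/
def ichoose (t : ℤ) (b : ℕ) : ℤ :=
  if t < (b : ℤ) then 0 else ((t.toNat.choose b : ℕ) : ℤ)

open Finset

/-- The sum of the first `i` entries of `f`. -/
def prefixSum {m : ℕ} (f : Fin m → ℕ) (i : ℕ) : ℕ :=
  ∑ k with k.val < i, f k

lemma prefixSum_zero {m : ℕ} (f : Fin m → ℕ) : prefixSum f 0 = 0 := by
  simp [prefixSum]

lemma prefixSum_self {m : ℕ} (f : Fin m → ℕ) : prefixSum f m = ∑ k, f k := by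
  simp [prefixSum]

lemma prefixSum_succ {m : ℕ} (f : Fin m → ℕ) (k : Fin m) :
    prefixSum f (k + 1) = prefixSum f k + f k := by
  have h : ({a : Fin m | a.val < k + 1} : Finset (Fin m)) =
      insert k ({a : Fin m | a.val < k} : Finset (Fin m)) := by
    ext a
    simp only [mem_filter, mem_univ, true_and, mem_insert, Fin.ext_iff]
    omega
  rw [prefixSum, h, sum_insert (by simp), add_comm, prefixSum]

lemma prefixSum_mono {m : ℕ} (f : Fin m → ℕ) : Monotone (prefixSum f) := fun i j hij =>
  sum_le_sum_of_subset fun a ha => by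
    simp only [mem_filter, mem_univ, true_and] at ha ⊢
    omega

/-- The sum of the entries in the top left `i × j` corner of a staircase matrix is determined
by the row sums and the column sums. -/
lemma IsStaircase.corner_eq {m n : ℕ} {p : Fin m → Fin n → ℕ} (hp : IsStaircase p) (i j : ℕ) :
    prefixSum (fun a => prefixSum (p a) j) i =
      min (prefixSum (fun a => ∑ b, p a b) i) (prefixSum (fun b => ∑ a, p a b) j) := by
  have hR : prefixSum (fun a => prefixSum (p a) j) i ≤ prefixSum (fun a => ∑ b, p a b) i :=
    sum_le_sum fun a _ => sum_le_sum_of_subset (filter_subset _ _)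
  have hswap : prefixSum (fun a => prefixSum (p a) j) i =
      prefixSum (fun b => prefixSum (fun a => p a b) i) j := by
    simp only [prefixSum]
    exact sum_comm
  have hS : prefixSum (fun a => prefixSum (p a) j) i ≤ prefixSum (fun b => ∑ a, p a b) j := by
    rw [hswap]
    exact sum_le_sum fun b _ => sum_le_sum_of_subset (filter_subset _ _)
  by_cases h : ∃ a : Fin m, ∃ b : Fin n, i ≤ a.val ∧ b.val < j ∧ 0 < p a b
  · obtain ⟨a, b, ha, hb, hab⟩ := h
    have : prefixSum (fun a => prefixSum (p a) j) i = prefixSum (fun a => ∑ b, p a b) i := by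
      refine sum_congr rfl fun a' ha' => sum_subset (filter_subset _ _) fun b' _ hb' => ?_
      simp only [mem_filter, mem_univ, true_and, not_lt] at ha' hb'
      exact hp a a' b b' hab (Fin.lt_def.2 (by omega)) (Fin.lt_def.2 (by omega))
    omega
  · push Not at h
    have : prefixSum (fun a => prefixSum (p a) j) i = prefixSum (fun b => ∑ a, p a b) j := by
      rw [hswap]
      refine sum_congr rfl fun b hb => sum_subset (filter_subset _ _) fun a _ ha => ?_
      simp only [mem_filter, mem_univ, true_and, not_lt] at ha hb
      exact Nat.le_zero.1 (h a b ha hb)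
    omega

/-- A staircase matrix is determined by its row sums and its column sums. -/
lemma IsStaircase.eq_of_sums_eq_s3 {m n : ℕ} {p p' : Fin m → Fin n → ℕ} (hp : IsStaircase p)
    (hp' : IsStaircase p') (hr : (fun a => ∑ b, p a b) = fun a => ∑ b, p' a b)
    (hc : (fun b => ∑ a, p a b) = fun b => ∑ a, p' a b) : p = p' := by
  have key (i j : ℕ) : prefixSum (fun a => prefixSum (p a) j) i =
      prefixSum (fun a => prefixSum (p' a) j) i := by
    rw [hp.corner_eq, hp'.corner_eq, hr, hc]
  have hrow (a : Fin m) (j : ℕ) : prefixSum (p a) j = prefixSum (p' a) j := by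
    have h := key (a + 1) j
    rw [prefixSum_succ, prefixSum_succ, key a j] at h
    exact Nat.add_left_cancel h
  funext a b
  have h := hrow a (b + 1)
  rw [prefixSum_succ, prefixSum_succ, hrow a b] at h
  exact Nat.add_left_cancel h

lemma sum_range_interval_overlap {S : ℕ → ℕ} (hS : Monotone S) {A B : ℕ} (hAB : A ≤ B) (n : ℕ) :
    ∑ b ∈ range n, (min B (S (b + 1)) - max A (S b)) + max A (min B (S 0)) =
      max A (min B (S n)) := by
  induction n with
  | zero => simp
  | succ n ih =>
    have := hS (Nat.le_add_right n 1)
    rw [sum_range_succ]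
    omega

lemma sum_interval_overlap {m n : ℕ} (r : Fin m → ℕ) (c : Fin n → ℕ)
    (h : ∑ a, r a = ∑ b, c b) (a : Fin m) :
    ∑ b : Fin n, (min (prefixSum r (a + 1)) (prefixSum c (b + 1)) -
      max (prefixSum r a) (prefixSum c b)) = r a := by
  rw [Fin.sum_univ_eq_sum_range fun b => min (prefixSum r (a + 1)) (prefixSum c (b + 1)) -
      max (prefixSum r a) (prefixSum c b)]
  have hle := prefixSum_mono r (Nat.le_add_right a 1)
  have key := sum_range_interval_overlap (prefixSum_mono c) hle n
  have htop := prefixSum_mono r (Nat.succ_le_of_lt a.isLt)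
  rw [prefixSum_self, h, ← prefixSum_self] at htop
  have hsucc := prefixSum_succ r a
  rw [prefixSum_zero] at key
  simp only [Nat.succ_eq_add_one] at htop
  omega

/-- Every pair of vectors with the same total is realised as the row sums and the column sums of
a staircase matrix. -/
lemma exists_isStaircase_of_sum_eq {m n : ℕ} (r : Fin m → ℕ) (c : Fin n → ℕ)
    (h : ∑ a, r a = ∑ b, c b) :
    ∃ p : Fin m → Fin n → ℕ, IsStaircase p ∧ (∀ a, ∑ b, p a b = r a) ∧
      ∀ b, ∑ a, p a b = c b := by
  refine ⟨fun a b => min (prefixSum r (a + 1)) (prefixSum c (b + 1)) -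
    max (prefixSum r a) (prefixSum c b), ?_, sum_interval_overlap r c h, fun b => ?_⟩
  · intro a a' b b' hab ha hb
    have h1 := prefixSum_mono c (Nat.succ_le_of_lt (Fin.lt_def.1 hb))
    have h2 := prefixSum_mono r (Nat.succ_le_of_lt (Fin.lt_def.1 ha))
    simp only [Nat.succ_eq_add_one] at h1 h2 hab ⊢
    omega
  · rw [← sum_interval_overlap c r h.symm b]
    exact sum_congr rfl fun a _ => by rw [min_comm, max_comm]

lemma card_piAntidiag_univ_fin (m s : ℕ) :
    #(piAntidiag (univ : Finset (Fin m)) s) = (m + s - 1).choose s := by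
  rw [← map_sym_eq_piAntidiag, card_map, sym_univ, card_univ, Sym.card_sym_eq_choose,
    Fintype.card_fin]

/-- Staircase matrices with column sums below `q`, counted by their column sums. -/
lemma ncard_isStaircase (m n q : ℕ) :
    Set.ncard {p : Fin m → Fin n → ℕ | IsStaircase p ∧ ∀ j : Fin n, ∑ i, p i j < q} =
      ∑ c ∈ Fintype.piFinset fun _ : Fin n => range q,
        (m + ∑ j, c j - 1).choose (∑ j, c j) := by
  let T : Finset ((_ : Fin n → ℕ) × (Fin m → ℕ)) :=
    (Fintype.piFinset fun _ : Fin n => range q).sigma fun c => piAntidiag univ (∑ j, c j)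
  let sums (p : Fin m → Fin n → ℕ) : (_ : Fin n → ℕ) × (Fin m → ℕ) :=
    ⟨fun b => ∑ a, p a b, fun a => ∑ b, p a b⟩
  have hinj : Set.InjOn sums
      {p : Fin m → Fin n → ℕ | IsStaircase p ∧ ∀ j : Fin n, ∑ i, p i j < q} := by
    intro p hp p' hp' h
    simp only [sums, Sigma.mk.injEq, heq_eq_eq] at h
    exact hp.1.eq_of_sums_eq_s3 hp'.1 h.2 h.1
  have himage : sums ''
      {p : Fin m → Fin n → ℕ | IsStaircase p ∧ ∀ j : Fin n, ∑ i, p i j < q} = T := by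
    ext ⟨c, r⟩
    simp only [Set.mem_image, Set.mem_ofPred_eq, sums, T, mem_coe, mem_sigma,
      Fintype.mem_piFinset, mem_range, mem_piAntidiag, Sigma.mk.injEq, heq_eq_eq, mem_univ,
      implies_true, and_true]
    constructor
    · rintro ⟨p, ⟨-, hq⟩, rfl, rfl⟩
      exact ⟨hq, sum_comm⟩
    · rintro ⟨hq, hr⟩
      obtain ⟨p, hp, hrow, hcol⟩ := exists_isStaircase_of_sum_eq r c hr
      exact ⟨p, ⟨hp, fun j => (hcol j).trans_lt (hq j)⟩, funext hcol, funext hrow⟩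
  rw [← hinj.ncard_image, himage, Set.ncard_coe_finset, card_sigma]
  exact sum_congr rfl fun c _ => card_piAntidiag_univ_fin m _

lemma sum_piFinset_succ {M : Type*} [AddCommMonoid M] (n : ℕ) (s : Finset ℕ)
    (f : (Fin (n + 1) → ℕ) → M) :
    ∑ c ∈ Fintype.piFinset (fun _ : Fin (n + 1) => s), f c =
      ∑ c ∈ Fintype.piFinset (fun _ : Fin n => s), ∑ a ∈ s, f (Fin.cons a c) := by
  rw [← sum_product']
  refine sum_nbij' (fun c => (Fin.tail c, c 0)) (fun x => Fin.cons x.2 x.1) ?_ ?_ ?_ ?_ ?_ <;>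
    simp [Fin.forall_iff_succ, Fin.tail] <;> tauto

/-- Summing a function of the coordinate sum over a box of side `q` amounts to taking iterated
differences of step `q` of an iterated antidifference. -/
lemma sum_box_eq_fwdDiff_iter {G : ℕ → ℕ → ℤ}
    (hG : ∀ k x, G (k + 1) (x + 1) = G (k + 1) x + G k x) (n q k x : ℕ) :
    ∑ c ∈ Fintype.piFinset (fun _ : Fin n => range q), G k (x + ∑ j, c j) =
      (fwdDiff q)^[n] (G (k + n)) x := by
  induction n generalizing k x with
  | zero => simp
  | succ n ih =>
    have hsum (y : ℕ) : ∑ a ∈ range q, G k (y + a) = G (k + 1) (y + q) - G (k + 1) y := by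
      rw [← add_zero y, add_assoc, zero_add, ← sum_range_sub fun a => G (k + 1) (y + a)]
      refine sum_congr rfl fun a _ => ?_
      rw [← add_assoc y, hG, add_zero]
      ring
    rw [sum_piFinset_succ, Function.iterate_succ_apply', fwdDiff, ← add_assoc, add_right_comm,
      ← ih, ← ih, ← sum_sub_distrib]
    refine sum_congr rfl fun c _ => ?_
    rw [add_right_comm, ← hsum]
    refine sum_congr rfl fun a _ => ?_
    rw [Fin.sum_cons, add_assoc, add_comm a]

theorem stmt_3 (m n q : ℕ) (hm : 0 < m) (hn : 0 < n) (hq : 0 < q) :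
    ((Set.ncard {p : Fin m → Fin n → ℕ |
        IsStaircase p ∧ ∀ j : Fin n, ∑ i, p i j < q} : ℕ) : ℤ)
      = ∑ i ∈ Finset.Icc 1 n, (-1 : ℤ) ^ (n - i) * (n.choose i : ℤ) *
          ichoose ((i : ℤ) * q + m - 1) (m + n - 1) := by
  obtain ⟨d, rfl⟩ : ∃ d, m = d + 1 := ⟨m - 1, by omega⟩
  have hich (i : ℕ) : ichoose ((i : ℤ) * q + (d + 1 : ℕ) - 1) (d + 1 + n - 1) =
      ((i * q + d).choose (d + n) : ℤ) := by
    have h1 : (i : ℤ) * q + (d + 1 : ℕ) - 1 = (i * q + d : ℕ) := by push_cast; ring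
    have h2 : d + 1 + n - 1 = d + n := by omega
    rw [h1, h2, ichoose, Int.toNat_natCast]
    split_ifs with h
    · rw [Nat.choose_eq_zero_of_lt (by exact_mod_cast h), Nat.cast_zero]
    · rfl
  have key := sum_box_eq_fwdDiff_iter (G := fun k x => ((x + d).choose (d + k) : ℤ))
    (fun k x => by
      rw [add_right_comm x, ← add_assoc d, Nat.choose_succ_succ]
      push_cast
      ring) n q 0 0
  rw [fwdDiff_iter_eq_sum_shift, sum_range_eq_add_Ico _ (by omega)] at key
  simp only [zero_add, add_zero, smul_eq_mul, zero_mul,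
    Nat.choose_eq_zero_of_lt (show d < d + n by omega), Nat.cast_zero, mul_zero] at key
  rw [ncard_isStaircase, ← Finset.Ico_add_one_right_eq_Icc]
  simp_rw [hich]
  rw [Nat.cast_sum]
  refine Eq.trans (sum_congr rfl fun c _ => ?_) key
  rw [add_right_comm, Nat.add_sub_cancel, ← Nat.choose_symm_add, add_comm d]
end

section
/- Let $m, n, q$ be positive integers. The number of staircase $m \times n$ matrices $(p_{i,j})$ of non-negative integers such that $\sum_{i=1}^m p_{i,j} < q$ for every column index $j \in \{1,\dots,n\}$ equals the number of $(m+n-1)$-tuples of non-negative integers that sum up to at most $n(q-1)$ and whose first $n$ entries are all strictly smaller than $q$. -/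
open Finset in
/-- The block sums of a staircase matrix are the minima of the partial sums of its margins. -/
theorem IsStaircase.sum_block_eq_min {m n : ℕ} {p : Fin m → Fin n → ℕ} (hp : IsStaircase p)
    (a b : ℕ) :
    ∑ i with i.val < a, ∑ j with j.val < b, p i j
      = min (∑ i with i.val < a, ∑ j, p i j) (∑ j with j.val < b, ∑ i, p i j) := by
  have hrow : ∑ i with i.val < a, ∑ j, p i j
      = ∑ i with i.val < a, ∑ j with j.val < b, p i j
        + ∑ i with i.val < a, ∑ j with ¬ j.val < b, p i j := by
    rw [← sum_add_distrib]
    exact sum_congr rfl fun i _ => (sum_filter_add_sum_filter_not _ _ _).symm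
  have hcol : ∑ j with j.val < b, ∑ i, p i j
      = ∑ i with i.val < a, ∑ j with j.val < b, p i j
        + ∑ i with ¬ i.val < a, ∑ j with j.val < b, p i j := by
    rw [sum_comm, sum_filter_add_sum_filter_not]
  by_cases h : ∃ i : Fin m, ∃ j : Fin n, i.val < a ∧ ¬ j.val < b ∧ p i j ≠ 0
  · obtain ⟨i, j, hi, hj, hne⟩ := h
    have hz : ∑ i with ¬ i.val < a, ∑ j with j.val < b, p i j = 0 := by
      refine sum_eq_zero fun i' hi' => sum_eq_zero fun j' hj' => ?_
      simp only [mem_filter, mem_univ, true_and] at hi' hj'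
      by_contra h0
      exact hne (hp i' i j' j (Nat.pos_of_ne_zero h0) (Fin.lt_def.2 (by omega))
        (Fin.lt_def.2 (by omega)))
    omega
  · push Not at h
    have hz : ∑ i with i.val < a, ∑ j with ¬ j.val < b, p i j = 0 := by
      refine sum_eq_zero fun i' hi' => sum_eq_zero fun j' hj' => ?_
      simp only [mem_filter, mem_univ, true_and] at hi' hj'
      exact h i' j' hi' (by omega)
    omega

open Finset in
theorem sum_filter_val_lt_succ {n : ℕ} (f : Fin n → ℕ) (j : Fin n) :
    ∑ k with k.val < j.val + 1, f k = ∑ k with k.val < j.val, f k + f j := by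
  have h : (univ.filter fun k : Fin n => k.val < j.val + 1)
      = insert j (univ.filter fun k : Fin n => k.val < j.val) := by
    ext k
    simp only [mem_filter, mem_univ, true_and, mem_insert, Fin.ext_iff]
    omega
  rw [h, sum_insert (by simp), add_comm]

/-- A staircase matrix is determined by its margins. -/
theorem IsStaircase.eq_of_margins_eq {m n : ℕ} {p p' : Fin m → Fin n → ℕ}
    (hp : IsStaircase p) (hp' : IsStaircase p')
    (hrow : ∀ i, ∑ j, p i j = ∑ j, p' i j) (hcol : ∀ j, ∑ i, p i j = ∑ i, p' i j) :
    p = p' := by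
  have hS (a b : ℕ) : ∑ i with i.val < a, ∑ j with j.val < b, p i j
      = ∑ i with i.val < a, ∑ j with j.val < b, p' i j := by
    rw [hp.sum_block_eq_min, hp'.sum_block_eq_min]
    simp only [hrow, hcol]
  have hR (i : Fin m) (b : ℕ) : ∑ j with j.val < b, p i j = ∑ j with j.val < b, p' i j := by
    have h₁ := hS (i.val + 1) b
    have h₂ := hS i.val b
    rw [sum_filter_val_lt_succ, sum_filter_val_lt_succ] at h₁
    omega
  funext i j
  have h₁ := hR i (j.val + 1)
  have h₂ := hR i j.val
  rw [sum_filter_val_lt_succ, sum_filter_val_lt_succ] at h₁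
  omega

/-- The length of the overlap of consecutive intervals with a fixed interval, summed up. -/
theorem sum_range_overlap {R : ℕ → ℕ} (hR : Monotone R) (h0 : R 0 = 0) {s t : ℕ} (hst : s ≤ t)
    (a : ℕ) :
    ∑ i ∈ Finset.range a, (min (R (i + 1)) t - max (R i) s) = min (R a) t - min (R a) s := by
  induction a with
  | zero => simp [h0]
  | succ a ih =>
    have := hR (Nat.le_add_right a 1)
    rw [Finset.sum_range_succ, ih]
    omega

/-- Any margins with equal totals are those of a staircase matrix. -/
theorem exists_isStaircase_of_margins {m n : ℕ} (r : Fin m → ℕ) (c : Fin n → ℕ)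
    (h : ∑ i, r i = ∑ j, c j) :
    ∃ p : Fin m → Fin n → ℕ, IsStaircase p ∧ (∀ i, ∑ j, p i j = r i) ∧
      ∀ j, ∑ i, p i j = c j := by
  have key {k : ℕ} (f : Fin k → ℕ) : ∃ F : ℕ → ℕ, Monotone F ∧ F 0 = 0 ∧ F k = ∑ i, f i ∧
      ∀ i : Fin k, F (i.val + 1) = F i.val + f i := by
    refine ⟨fun a => ∑ i with i.val < a, f i, fun a b hab => ?_, by simp, by simp,
      sum_filter_val_lt_succ f⟩
    refine Finset.sum_le_sum_of_subset fun i hi => ?_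
    simp only [Finset.mem_filter, Finset.mem_univ, true_and] at hi ⊢
    omega
  obtain ⟨R, hR, hR0, hRm, hRs⟩ := key r
  obtain ⟨C, hC, hC0, hCn, hCs⟩ := key c
  refine ⟨fun i j => min (R (i.val + 1)) (C (j.val + 1)) - max (R i.val) (C j.val),
    fun i i' j j' hpos hi hj => ?_, fun i => ?_, fun j => ?_⟩
  · have h₁ : R (i'.val + 1) ≤ R i.val := hR hi
    have h₂ : C (j.val + 1) ≤ C j'.val := hC hj
    dsimp only at hpos ⊢
    omega
  · have h₁ := Fin.sum_univ_eq_sum_range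
      (fun j => min (C (j + 1)) (R (i.val + 1)) - max (C j) (R i.val)) n
    have h₂ : R (i.val + 1) ≤ R m := hR i.isLt
    have h₃ := hRs i
    rw [sum_range_overlap hC hC0 (hR (Nat.le_add_right _ 1))] at h₁
    simp only [min_comm (R _), max_comm (R _)]
    omega
  · have h₁ := Fin.sum_univ_eq_sum_range
      (fun i => min (R (i + 1)) (C (j.val + 1)) - max (R i) (C j.val)) m
    have h₂ : C (j.val + 1) ≤ C n := hC j.isLt
    have h₃ := hCs j
    rw [sum_range_overlap hR hR0 (hC (Nat.le_add_right _ 1))] at h₁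
    dsimp only
    omega

/-- Staircase matrices with bounded column sums correspond to pairs of margins. -/
theorem ncard_isStaircase_eq_ncard_margins (m n q : ℕ) :
    Set.ncard {p : Fin m → Fin n → ℕ | IsStaircase p ∧ ∀ j : Fin n, ∑ i, p i j < q}
      = Set.ncard {x : (Fin m → ℕ) × (Fin n → ℕ) |
          ∑ i, x.1 i = ∑ j, x.2 j ∧ ∀ j, x.2 j < q} := by
  refine Set.ncard_congr (fun p _ => (fun i => ∑ j, p i j, fun j => ∑ i, p i j)) ?_ ?_ ?_
  · intro p hp
    have h : ∑ i, ∑ j, p i j = ∑ j, ∑ i, p i j := Finset.sum_comm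
    exact ⟨h, hp.2⟩
  · intro p p' hp hp' heq
    rw [Prod.mk.injEq] at heq
    exact hp.1.eq_of_margins_eq hp'.1 (congrFun heq.1) (congrFun heq.2)
  · rintro ⟨r, c⟩ ⟨h, hc⟩
    obtain ⟨p, hp, hr, hc'⟩ := exists_isStaircase_of_margins r c h
    exact ⟨p, ⟨hp, fun j => by rw [hc']; exact hc j⟩, Prod.ext (funext hr) (funext hc')⟩

theorem sum_sub_add_sum {n q : ℕ} (c : Fin n → ℕ) (hc : ∀ j, c j < q) :
    ∑ j, (q - 1 - c j) + ∑ j, c j = n * (q - 1) := by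
  rw [← Finset.sum_add_distrib, Finset.sum_congr rfl fun j _ =>
    Nat.sub_add_cancel (Nat.le_sub_one_of_lt (hc j))]
  simp

/-- Complementing the column margins and dropping the first row margin turns pairs of margins
into tuples of bounded sum. -/
theorem ncard_margins_eq_ncard_tuples (k n q : ℕ) (hq : 0 < q) :
    Set.ncard {x : (Fin (k + 1) → ℕ) × (Fin n → ℕ) |
          ∑ i, x.1 i = ∑ j, x.2 j ∧ ∀ j, x.2 j < q}
      = Set.ncard {v : Fin (n + k) → ℕ |
          ∑ i, v i ≤ n * (q - 1) ∧ ∀ i : Fin (n + k), (i : ℕ) < n → v i < q} := by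
  refine Set.ncard_congr (fun x _ => Fin.append (fun j => q - 1 - x.2 j) (Fin.tail x.1)) ?_ ?_ ?_
  · rintro ⟨r, c⟩ ⟨h, hc⟩
    dsimp only at h hc ⊢
    have hs := sum_sub_add_sum c hc
    rw [Fin.sum_univ_succ] at h
    refine ⟨?_, fun i hi => ?_⟩
    · simp only [Fin.sum_univ_add, Fin.append_left, Fin.append_right, Fin.tail]
      omega
    · obtain ⟨j, rfl⟩ : ∃ j : Fin n, i = Fin.castAdd k j := ⟨⟨i, hi⟩, rfl⟩
      rw [Fin.append_left]
      omega
  · rintro ⟨r, c⟩ ⟨r', c'⟩ ⟨h, hc⟩ ⟨h', hc'⟩ heq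
    dsimp only at h hc h' hc' heq
    have hcc : c = c' := by
      funext j
      have := congrFun heq (Fin.castAdd k j)
      simp only [Fin.append_left] at this
      have h₁ := hc j
      have h₂ := hc' j
      omega
    have ht (i : Fin k) : r i.succ = r' i.succ := by
      simpa [Fin.tail] using congrFun heq (Fin.natAdd n i)
    subst hcc
    rw [Fin.sum_univ_succ] at h h'
    simp only [ht] at h
    refine Prod.ext (funext fun i => ?_) rfl
    refine Fin.cases ?_ ht i
    change r 0 = r' 0
    omega
  · rintro v ⟨hv, hb⟩
    have hb' (j : Fin n) : v (Fin.castAdd k j) < q := hb _ j.isLt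
    have hs := sum_sub_add_sum (fun j => v (Fin.castAdd k j)) hb'
    refine ⟨(Fin.cons (n * (q - 1) - ∑ i, v i) fun i => v (Fin.natAdd n i),
      fun j => q - 1 - v (Fin.castAdd k j)), ⟨?_, fun j => ?_⟩, ?_⟩
    · rw [Fin.sum_univ_add] at hv
      simp only [Fin.sum_univ_add v, Fin.sum_univ_succ, Fin.cons_zero, Fin.cons_succ]
      omega
    · dsimp only
      omega
    · funext i
      refine Fin.addCases (fun j => ?_) (fun j => ?_) i
      · have := hb' j
        simp only [Fin.append_left]
        omega
      · simp

theorem stmt_4 (m n q : ℕ) (hm : 0 < m) (hn : 0 < n) (hq : 0 < q) :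
    Set.ncard {p : Fin m → Fin n → ℕ |
        IsStaircase p ∧ ∀ j : Fin n, ∑ i, p i j < q}
      = Set.ncard {v : Fin (m + n - 1) → ℕ |
          (∑ i, v i) ≤ n * (q - 1) ∧ ∀ i : Fin (m + n - 1), (i : ℕ) < n → v i < q} := by
  obtain ⟨k, rfl⟩ : ∃ k, m = k + 1 := ⟨m - 1, by omega⟩
  have hN : k + 1 + n - 1 = n + k := by omega
  rw [ncard_isStaircase_eq_ncard_margins, ncard_margins_eq_ncard_tuples k n q hq, hN]
end

section
/- Let $k$ be a field, let $m, n, q$ be positive integers, and let $k[X]$ be the polynomial ring in the $mn$ variables $x_{i,j}$ ($1 \le i \le m$, $1 \le j \le n$). Let $I_2(X)$ be the ideal of $k[X]$ generated by the $2 \times 2$ minors $x_{i,j} x_{i',j'} - x_{i,j'} x_{i',j}$ for $i < i'$ and $j < j'$. Then the dimension of the $k$-vector space $k[X] / \left(I_2(X) + (x_{i,j}^q : \text{all } i,j) + \sum_{j=1}^{n} (x_{1,j}, \dots, x_{m,j})^q\right)$ equals $\sum_{i=1}^{n} (-1)^{n-i}\binom{n}{i}\binom{iq + m - 1}{m+n-1}$.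 -/
open MvPolynomial

theorem prod_map_eq_of_marginals {α β M : Type*} [CommMonoid M] (y : α × β → M)
    (hy : ∀ i i' j j', y (i, j) * y (i', j') = y (i, j') * y (i', j))
    (s t : Multiset (α × β)) (h₁ : s.map Prod.fst = t.map Prod.fst)
    (h₂ : s.map Prod.snd = t.map Prod.snd) : (s.map y).prod = (t.map y).prod := by
  classical
  induction s using Multiset.induction_on generalizing t with
  | empty =>
    have : t = 0 := by simpa using h₁.symm
    simp [this]
  | cons p s ih =>
    obtain ⟨i, j⟩ := p
    by_cases hp : (i, j) ∈ t
    · obtain ⟨t, rfl⟩ := Multiset.exists_cons_of_mem hp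
      simp only [Multiset.map_cons, Multiset.cons_inj_right, Multiset.prod_cons] at h₁ h₂ ⊢
      rw [ih t h₁ h₂]
    · have hi : i ∈ t.map Prod.fst := by simp [← h₁]
      have hj : j ∈ t.map Prod.snd := by simp [← h₂]
      obtain ⟨⟨i, j'⟩, hi', rfl⟩ := Multiset.mem_map.1 hi
      obtain ⟨t, rfl⟩ := Multiset.exists_cons_of_mem hi'
      obtain ⟨⟨i', j⟩, hj', rfl⟩ := Multiset.mem_map.1 hj
      have hj' := (Multiset.mem_cons.1 hj').resolve_left (by grind)
      obtain ⟨t, rfl⟩ := Multiset.exists_cons_of_mem hj'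
      have := ih ((i', j') ::ₘ t)
        (by simpa using h₁) (by
          rw [Multiset.map_cons, Multiset.map_cons, Multiset.map_cons, Multiset.cons_swap] at h₂
          simpa using h₂)
      simp only [Multiset.map_cons, Multiset.prod_cons] at this ⊢
      rw [this, ← mul_assoc, hy, mul_assoc]

theorem exists_marginals {α β : Type*} (s : Multiset α) (t : Multiset β)
    (h : s.card = t.card) :
    ∃ u : Multiset (α × β), u.map Prod.fst = s ∧ u.map Prod.snd = t := by
  induction s using Quotient.inductionOn with | _ l
  induction t using Quotient.inductionOn with | _ l'
  have h : l.length = l'.length := h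
  refine ⟨(l.zip l' : List (α × β)), ?_, ?_⟩
  · simp [List.map_fst_zip h.le]
  · simp [List.map_snd_zip h.ge]

theorem sum_choose_add (p a q : ℕ) :
    ∑ c : Fin q, ((a + c).choose p : ℤ) = (a + q).choose (p + 1) - a.choose (p + 1) := by
  rw [Fin.sum_univ_eq_sum_range (fun c => ((a + c).choose p : ℤ))]
  induction q with
  | zero => simp
  | succ q ih =>
    rw [Finset.sum_range_succ, ih, ← add_assoc, Nat.choose_succ_succ]
    push_cast
    ring

theorem sum_choose_add_sum (n p q a : ℕ) :
    ∑ b : Fin n → Fin q, ((a + ∑ j, (b j : ℕ)).choose p : ℤ) =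
      ∑ i ∈ Finset.range (n + 1), (-1 : ℤ) ^ (n - i) * n.choose i * (a + i * q).choose (p + n) := by
  have key : ∑ b : Fin n → Fin q, ((a + ∑ j, (b j : ℕ)).choose p : ℤ) =
      (fwdDiff q)^[n] (fun t => (t.choose (p + n) : ℤ)) a := by
    induction n generalizing a with
    | zero => simp
    | succ n ih =>
      rw [← (Fin.consEquiv fun _ : Fin (n + 1) => Fin q).sum_comp, Fintype.sum_prod_type]
      simp only [Fin.consEquiv, Equiv.coe_fn_mk, Fin.sum_univ_succ, Fin.cons_zero, Fin.cons_succ,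
        ← add_assoc, ih, Function.iterate_succ_apply]
      have : fwdDiff q (fun t => (t.choose (p + n + 1) : ℤ)) =
          fun t : ℕ => ∑ c : Fin q, ((t + (c : ℕ)).choose (p + n) : ℤ) := by
        ext t
        rw [sum_choose_add, fwdDiff]
      rw [this]
      simp only [fwdDiff_iter_eq_sum_shift, Finset.smul_sum]
      rw [Finset.sum_comm]
      simp only [add_right_comm]
  rw [key, fwdDiff_iter_eq_sum_shift]
  simp

theorem multiset_prod_mem_pow {ι R : Type*} [CommSemiring R] (I : Ideal R) (f : ι → R)
    (s : Multiset ι) (h : ∀ x ∈ s, f x ∈ I) : (s.map f).prod ∈ I ^ s.card := by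
  induction s using Multiset.induction_on with
  | empty => simp
  | cons a s ih =>
    rw [Multiset.map_cons, Multiset.prod_cons, Multiset.card_cons, pow_succ']
    exact Ideal.mul_mem_mul (h a (by simp)) (ih fun x hx => h x (by simp [hx]))

theorem prod_map_X_eq_monomial {σ k : Type*} [DecidableEq σ] [CommSemiring k] (u : Multiset σ) :
    (u.map X).prod = (monomial (Multiset.toFinsupp u) 1 : MvPolynomial σ k) := by
  induction u using Multiset.induction_on with
  | empty => simp
  | cons a u ih =>
    rw [Multiset.map_cons, Multiset.prod_cons, ih, ← Multiset.singleton_add, map_add,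
      Multiset.toFinsupp_singleton, X, monomial_mul, one_mul]

/-- The homomorphism `x_{i,j} ↦ s_i t_j` onto the Segre subring. -/
noncomputable def segreHom (k α β : Type*) [CommSemiring k] :
    MvPolynomial (α × β) k →ₐ[k] MvPolynomial (α ⊕ β) k :=
  aeval fun p => X (Sum.inl p.1) * X (Sum.inr p.2)

/-- The exponent of the monomial `∏_{i ∈ s} s_i ∏_{j ∈ t} t_j`. -/
noncomputable def segreExp {α β : Type*} [DecidableEq α] [DecidableEq β] (s : Multiset α) (t : Multiset β) :
    α ⊕ β →₀ ℕ :=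
  Multiset.toFinsupp (s.map Sum.inl + t.map Sum.inr)

section

variable {α β : Type*} [DecidableEq α] [DecidableEq β]

theorem segreExp_inl (s : Multiset α) (t : Multiset β) (i : α) :
    segreExp s t (Sum.inl i) = s.count i := by
  simp [segreExp, Multiset.count_map_eq_count' _ _ Sum.inl_injective]

theorem segreExp_inr (s : Multiset α) (t : Multiset β) (j : β) :
    segreExp s t (Sum.inr j) = t.count j := by
  simp [segreExp, Multiset.count_map_eq_count' _ _ Sum.inr_injective]

theorem segreExp_inj {s s' : Multiset α} {t t' : Multiset β} :
    segreExp s t = segreExp s' t' ↔ s = s' ∧ t = t' := by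
  refine ⟨fun h => ⟨?_, ?_⟩, by rintro ⟨rfl, rfl⟩; rfl⟩
  · ext i
    rw [← segreExp_inl s t, h, segreExp_inl]
  · ext j
    rw [← segreExp_inr s t, h, segreExp_inr]

theorem segreHom_prod_map_X {k : Type*} [CommSemiring k] (u : Multiset (α × β)) :
    segreHom k α β (u.map X).prod =
      monomial (segreExp (u.map Prod.fst) (u.map Prod.snd)) 1 := by
  rw [segreExp, ← prod_map_X_eq_monomial, map_multiset_prod]
  simp [segreHom, Multiset.map_map, Multiset.prod_map_mul]

end

theorem finrank_quotient_segre {k α β : Type*} [Field k] [Fintype α] [Fintype β] [DecidableEq α]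
    [DecidableEq β] (q : ℕ) (I : Ideal (MvPolynomial (α × β) k))
    (hI : I ≤ (Ideal.span ((fun e => monomial e (1 : k)) ''
      Set.range fun j : β => Finsupp.single (Sum.inr j : α ⊕ β) q)).comap (segreHom k α β))
    (hminor : ∀ i i' j j', X (i, j) * X (i', j') - X (i, j') * X (i', j) ∈ I)
    (hcol : ∀ j, Ideal.span (Set.range fun i => X (i, j)) ^ q ≤ I) :
    Module.finrank k (MvPolynomial (α × β) k ⧸ I) =
      Fintype.card (Σ b : β → Fin q, Sym α (∑ j, (b j : ℕ))) := by
  let T := Σ b : β → Fin q, Sym α (∑ j, (b j : ℕ))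
  let B : T → Multiset β := fun t => ∑ j, Multiset.replicate (t.1 j : ℕ) j
  have hB (t : T) (j : β) : (B t).count j = t.1 j := by
    simp [B, Multiset.count_sum', Multiset.count_replicate]
  have hBcard (t : T) : (B t).card = ∑ j, (t.1 j : ℕ) := by simp [B]
  let e : T → (α ⊕ β →₀ ℕ) := fun t => segreExp (t.2 : Multiset α) (B t)
  have he : Function.Injective e := by
    rintro ⟨b, s⟩ ⟨b', s'⟩ h
    obtain ⟨h₁, h₂⟩ := segreExp_inj.1 h
    obtain rfl : b = b' := by
      ext j
      rw [← hB ⟨b, s⟩ j, h₂, hB]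
    congr 1
    exact Subtype.ext h₁
  choose w hw₁ hw₂ using fun t : T =>
    exists_marginals (t.2 : Multiset α) (B t) (by rw [hBcard]; exact t.2.2)
  let L : MvPolynomial (α × β) k →ₗ[k] (T → k) :=
    LinearMap.pi fun t => (lcoeff k (e t)).comp (segreHom k α β).toLinearMap
  have hL (f t) : L f t = coeff (e t) (segreHom k α β f) := rfl
  have hLw (t : T) : L ((w t).map X).prod = Pi.single t 1 := by
    ext t'
    rw [hL, segreHom_prod_map_X, hw₁, hw₂, coeff_monomial, Pi.single_apply]
    exact if_congr (he.eq_iff.trans eq_comm) rfl rfl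
  have hsub_prod (u : Multiset (α × β)) :
      (u.map X).prod - ∑ t, L (u.map X).prod t • ((w t).map X).prod ∈ I := by
    have hLu : ∀ t, L (u.map X).prod t =
        if segreExp (u.map Prod.fst) (u.map Prod.snd) = e t then 1 else 0 := fun t => by
      rw [hL, segreHom_prod_map_X, coeff_monomial]
    by_cases hu : ∀ j, (u.map Prod.snd).count j < q
    · let b : β → Fin q := fun j => ⟨(u.map Prod.snd).count j, hu j⟩
      have hcard : (u.map Prod.fst).card = ∑ j, (b j : ℕ) := by
        simp only [b, Multiset.card_map]
        rw [Multiset.sum_count_eq_card fun _ _ => Finset.mem_univ _, Multiset.card_map]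
      let t : T := ⟨b, ⟨u.map Prod.fst, hcard⟩⟩
      have hBt : B t = u.map Prod.snd := Multiset.ext.2 fun j => hB t j
      have het : segreExp (u.map Prod.fst) (u.map Prod.snd) = e t := by rw [← hBt]; rfl
      have hval : ∀ t', L (u.map X).prod t' = if t = t' then 1 else 0 := fun t' => by
        rw [hLu, het]
        exact if_congr he.eq_iff rfl rfl
      simp only [hval, ite_smul, one_smul, zero_smul, Finset.sum_ite_eq, Finset.mem_univ, if_true]
      rw [← Ideal.Quotient.mk_eq_mk_iff_sub_mem, map_multiset_prod, map_multiset_prod,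
        Multiset.map_map, Multiset.map_map]
      refine prod_map_eq_of_marginals _ (fun i i' j j' => ?_) _ _ (hw₁ t).symm ?_
      · simp only [Function.comp_apply, ← map_mul]
        exact Ideal.Quotient.mk_eq_mk_iff_sub_mem _ _ |>.2 (hminor i i' j j')
      · rw [hw₂, hBt]
    · push Not at hu
      obtain ⟨j, hj⟩ := hu
      have hzero : ∀ t, L (u.map X).prod t = 0 := fun t => by
        rw [hLu, if_neg]
        intro h
        rw [(segreExp_inj.1 h).2, hB] at hj
        exact absurd hj (t.1 j).2.not_ge
      simp only [hzero, zero_smul, Finset.sum_const_zero, sub_zero]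
      have hmem := multiset_prod_mem_pow (Ideal.span (Set.range fun i : α => X (R := k) (i, j))) X
        (u.filter fun p => j = p.2) fun p hp => Ideal.subset_span
          ⟨p.1, by rw [(Multiset.mem_filter.1 hp).2]⟩
      rw [← Multiset.filter_add_not (fun p => j = p.2) u, Multiset.map_add, Multiset.prod_add]
      rw [Multiset.count_map] at hj
      exact I.mul_mem_right _ (hcol j (Ideal.pow_le_pow_right hj hmem))
  have hsub (f) : f - ∑ t, L f t • ((w t).map X).prod ∈ I := by
    induction f using MvPolynomial.induction_on' with
    | add f g hf hg =>
      convert I.add_mem hf hg using 1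
      simp only [map_add, Pi.add_apply, add_smul, Finset.sum_add_distrib]
      ring
    | monomial u a =>
      have hu : monomial u a = a • ((Finsupp.toMultiset u).map X).prod := by
        rw [prod_map_X_eq_monomial, Finsupp.toMultiset_toFinsupp, smul_monomial, smul_eq_mul,
          mul_one]
      have := Submodule.smul_of_tower_mem I a (hsub_prod (Finsupp.toMultiset u))
      simpa only [hu, map_smul, Pi.smul_apply, smul_assoc, smul_sub, Finset.smul_sum] using this
  have hker : LinearMap.ker L = I.restrictScalars k := by
    ext f
    rw [LinearMap.mem_ker, Submodule.restrictScalars_mem]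
    refine ⟨fun h => by simpa [h] using hsub f, fun h => funext fun t => ?_⟩
    by_contra hne
    obtain ⟨_, ⟨j, rfl⟩, hj⟩ := mem_ideal_span_monomial_image.1 (hI h) (e t)
      (mem_support_iff.2 hne)
    have := hj (Sum.inr j)
    rw [Finsupp.single_eq_same, segreExp_inr, hB] at this
    exact absurd this (t.1 j).2.not_ge
  have hsurj : Function.Surjective L := fun v => by
    refine ⟨∑ t, v t • ((w t).map X).prod, ?_⟩
    simp only [map_sum, map_smul, hLw]
    ext t
    simp [Finset.sum_apply, Pi.single_apply]
  rw [← (Submodule.Quotient.restrictScalarsEquiv k I).finrank_eq, ← hker,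
    (L.quotKerEquivOfSurjective hsurj).finrank_eq, Module.finrank_fintype_fun_eq_card]

theorem card_sigma_sym (m n q : ℕ) (hm : 0 < m) :
    (Fintype.card (Σ b : Fin n → Fin q, Sym (Fin m) (∑ j, (b j : ℕ))) : ℤ) =
      ∑ i ∈ Finset.range (n + 1), (-1 : ℤ) ^ (n - i) * n.choose i *
        (i * q + m - 1).choose (m + n - 1) := by
  obtain ⟨p, rfl⟩ : ∃ p, m = p + 1 := ⟨m - 1, by omega⟩
  simp only [Fintype.card_sigma, Sym.card_sym_eq_multichoose, Fintype.card_fin, Nat.cast_sum]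
  have h := sum_choose_add_sum n p q p
  refine (Finset.sum_congr rfl fun b _ => ?_).trans (h.trans (Finset.sum_congr rfl fun i _ => ?_))
  · rw [Nat.multichoose_eq, add_right_comm, Nat.add_sub_cancel, ← Nat.choose_symm_add]
  · rw [show i * q + (p + 1) - 1 = p + i * q by omega, show p + 1 + n - 1 = p + n by omega]


theorem stmt_5 (k : Type*) [Field k] (m n q : ℕ) (hm : 0 < m) (hn : 0 < n) (hq : 0 < q)
    (I2 : Ideal (MvPolynomial (Fin m × Fin n) k))
    (hI2 : I2 = Ideal.span {f | ∃ (i i' : Fin m) (j j' : Fin n), i < i' ∧ j < j' ∧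
      f = X (i, j) * X (i', j') - X (i, j') * X (i', j)})
    (J : Ideal (MvPolynomial (Fin m × Fin n) k))
    (hJ : J = Ideal.span {f | ∃ ij : Fin m × Fin n, f = X ij ^ q})
    (C : Fin n → Ideal (MvPolynomial (Fin m × Fin n) k))
    (hC : ∀ j, C j = Ideal.span {f | ∃ i : Fin m, f = X (i, j)}) :
    ((Module.finrank k
        (MvPolynomial (Fin m × Fin n) k ⧸ (I2 + J + ∑ j : Fin n, (C j) ^ q)) : ℕ) : ℤ)
      = ∑ i ∈ Finset.Icc 1 n, (-1 : ℤ) ^ (n - i) * (n.choose i : ℤ) *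
          ichoose ((i : ℤ) * q + m - 1) (m + n - 1) := by
  subst hI2 hJ
  rw [finrank_quotient_segre q _ ?_ ?_ ?_, card_sigma_sym m n q hm]
  · rw [Finset.range_eq_Ico, Finset.sum_eq_sum_Ico_succ_bot (by omega)]
    have h₀ : (0 * q + m - 1).choose (m + n - 1) = 0 := Nat.choose_eq_zero_of_lt (by omega)
    rw [h₀, Nat.cast_zero, mul_zero, zero_add]
    refine Finset.sum_congr rfl fun i _ => ?_
    have hcast : (i : ℤ) * q + m - 1 = ((i * q + m - 1 : ℕ) : ℤ) := by
      push_cast [Nat.cast_sub (show 1 ≤ i * q + m by omega)]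
      ring
    rw [hcast, ichoose, Int.toNat_natCast]
    split_ifs with h
    · rw [Nat.choose_eq_zero_of_lt (Int.ofNat_lt.1 h), Nat.cast_zero]
    · rfl
  · have hX (j : Fin n) : (X (Sum.inr j) : MvPolynomial (Fin m ⊕ Fin n) k) ^ q ∈
        Ideal.span ((fun e => monomial e (1 : k)) ''
          Set.range fun j : Fin n => Finsupp.single (Sum.inr j : Fin m ⊕ Fin n) q) :=
      Ideal.subset_span ⟨_, ⟨j, rfl⟩, by simp [X_pow_eq_monomial]⟩
    refine sup_le (sup_le (Ideal.span_le.2 ?_) (Ideal.span_le.2 ?_)) ?_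
    · rintro _ ⟨i, i', j, j', -, -, rfl⟩
      rw [SetLike.mem_coe, Ideal.mem_comap]
      convert Ideal.zero_mem _
      simp only [segreHom, map_sub, map_mul, aeval_X]
      ring
    · rintro _ ⟨⟨i, j⟩, rfl⟩
      rw [SetLike.mem_coe, Ideal.mem_comap]
      simp only [segreHom, map_pow, aeval_X, mul_pow]
      exact Ideal.mul_mem_left _ _ (hX j)
    · rw [Ideal.sum_eq_sup]
      refine Finset.sup_le fun j _ => ?_
      have hle : (C j).map (segreHom k (Fin m) (Fin n)) ≤ Ideal.span {X (Sum.inr j)} := by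
        rw [hC, Ideal.map_span, Ideal.span_le]
        rintro _ ⟨_, ⟨i, rfl⟩, rfl⟩
        simpa [segreHom] using
          Ideal.mul_mem_left _ _ (Ideal.mem_span_singleton_self (X (Sum.inr j)))
      rw [← Ideal.map_le_iff_le_comap, Ideal.map_pow]
      refine (Ideal.pow_right_mono hle q).trans ?_
      rw [Ideal.span_singleton_pow, Ideal.span_singleton_le_iff_mem]
      exact hX j
  · have hlt (i i' : Fin m) (j j' : Fin n) (hi : i < i') (hj : j < j') :
        X (i, j) * X (i', j') - X (i, j') * X (i', j) ∈
          Ideal.span {f : MvPolynomial (Fin m × Fin n) k | ∃ (i i' : Fin m) (j j' : Fin n),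
            i < i' ∧ j < j' ∧ f = X (i, j) * X (i', j') - X (i, j') * X (i', j)} :=
      Ideal.subset_span ⟨i, i', j, j', hi, hj, rfl⟩
    intro i i' j j'
    refine Ideal.mem_sup_left (Ideal.mem_sup_left ?_)
    rcases lt_trichotomy i i' with hi | rfl | hi
    · rcases lt_trichotomy j j' with hj | rfl | hj
      · exact hlt i i' j j' hi hj
      · simp
      · rw [← neg_sub]
        exact neg_mem (hlt i i' j' j hi hj)
    · simp [mul_comm]
    · rcases lt_trichotomy j j' with hj | rfl | hj
      · convert neg_mem (hlt i' i j j' hi hj) using 1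
        ring
      · simp
      · convert hlt i' i j' j hi hj using 1
        ring
  · intro j
    have hCj : Ideal.span (Set.range fun i => X (i, j)) = C j := by
      rw [hC]
      congr 1
      ext f
      simp [eq_comm]
    rw [hCj, Ideal.sum_eq_sup]
    exact le_sup_of_le_right (Finset.le_sup (f := fun j => C j ^ q) (Finset.mem_univ j))
end

section
/- Let $m, n, q$ be positive integers. The number of staircase $m \times n$ matrices $(p_{i,j})$ of non-negative integers such that $\sum_{j=1}^n p_{i,j} \le q-1$ for every row index $i \in \{1,\dots,m\}$ and such that there exists a column index $j \in \{1,\dots,n\}$ with $\sum_{i=1}^m p_{i,j} \ge q$ equals $\sum_{i=1}^{n}\sum_{j=0}^{m} (-1)^{m-j+i-1}\binom{n}{i}\binom{m}{j}\binom{jq - iq + n - 1}{m+n-1}$. -/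
open Finset

/-- In a staircase array, one of the two off-diagonal blocks cut out by a corner vanishes, so the
mass of the upper left block is the smaller of the two marginal masses. -/
theorem sum_range_corner_eq_min {P : ℕ → ℕ → ℕ} {m n : ℕ}
    (hP : ∀ i i' j j', 0 < P i j → i' < i → j < j' → P i' j' = 0)
    {k l : ℕ} (hk : k ≤ m) (hl : l ≤ n) :
    ∑ x ∈ range k, ∑ y ∈ range l, P x y =
      min (∑ x ∈ range k, ∑ y ∈ range n, P x y) (∑ y ∈ range l, ∑ x ∈ range m, P x y) := by
  have h1 : ∑ x ∈ range k, ∑ y ∈ range n, P x y =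
      ∑ x ∈ range k, ∑ y ∈ range l, P x y + ∑ x ∈ range k, ∑ y ∈ Ico l n, P x y := by
    rw [← sum_add_distrib]
    exact sum_congr rfl fun x _ => (sum_range_add_sum_Ico _ hl).symm
  have h2 : ∑ y ∈ range l, ∑ x ∈ range m, P x y =
      ∑ x ∈ range k, ∑ y ∈ range l, P x y + ∑ y ∈ range l, ∑ x ∈ Ico k m, P x y := by
    rw [sum_comm (s := range k), ← sum_add_distrib]
    exact sum_congr rfl fun x _ => (sum_range_add_sum_Ico _ hk).symm
  have h3 : ∑ x ∈ range k, ∑ y ∈ Ico l n, P x y = 0 ∨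
      ∑ y ∈ range l, ∑ x ∈ Ico k m, P x y = 0 := by
    by_contra! h
    obtain ⟨x, hx, hx'⟩ := exists_ne_zero_of_sum_ne_zero h.1
    obtain ⟨y, hy, hxy⟩ := exists_ne_zero_of_sum_ne_zero hx'
    obtain ⟨y', hy', hy''⟩ := exists_ne_zero_of_sum_ne_zero h.2
    obtain ⟨x', hx1, hxy'⟩ := exists_ne_zero_of_sum_ne_zero hy''
    simp only [mem_range, mem_Ico] at *
    exact hxy (hP x' x y' y (by omega) (by omega) (by omega))
  omega

theorem staircase_unique {P Q : ℕ → ℕ → ℕ} {m n : ℕ}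
    (hP : ∀ i i' j j', 0 < P i j → i' < i → j < j' → P i' j' = 0)
    (hQ : ∀ i i' j j', 0 < Q i j → i' < i → j < j' → Q i' j' = 0)
    (hrow : ∀ i < m, ∑ j ∈ range n, P i j = ∑ j ∈ range n, Q i j)
    (hcol : ∀ j < n, ∑ i ∈ range m, P i j = ∑ i ∈ range m, Q i j)
    {i j : ℕ} (hi : i < m) (hj : j < n) : P i j = Q i j := by
  have key : ∀ k ≤ m, ∀ l ≤ n, ∑ x ∈ range k, ∑ y ∈ range l, P x y =
      ∑ x ∈ range k, ∑ y ∈ range l, Q x y := by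
    intro k hk l hl
    rw [sum_range_corner_eq_min hP hk hl, sum_range_corner_eq_min hQ hk hl]
    congr 1
    · exact sum_congr rfl fun x hx => hrow x (by simp at hx; omega)
    · exact sum_congr rfl fun x hx => hcol x (by simp at hx; omega)
  have h1 := key (i + 1) hi (j + 1) hj
  have h2 := key (i + 1) hi j hj.le
  have h3 := key i hi.le (j + 1) hj
  have h4 := key i hi.le j hj.le
  simp only [sum_range_succ _ i, sum_range_succ _ j] at h1 h2 h3
  omega

theorem staircase_exists {a b : ℕ → ℕ} {m n : ℕ}
    (hab : ∑ i ∈ range m, a i = ∑ j ∈ range n, b j) :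
    ∃ P : ℕ → ℕ → ℕ, (∀ i i' j j', 0 < P i j → i' < i → j < j' → P i' j' = 0) ∧
      (∀ i < m, ∑ j ∈ range n, P i j = a i) ∧ (∀ j < n, ∑ i ∈ range m, P i j = b j) := by
  set A : ℕ → ℕ := fun i => ∑ x ∈ range i, a x with hA
  set B : ℕ → ℕ := fun i => ∑ x ∈ range i, b x with hB
  have hA1 : ∀ i, A (i + 1) = A i + a i := fun i => sum_range_succ _ _
  have hB1 : ∀ i, B (i + 1) = B i + b i := fun i => sum_range_succ _ _
  have hA0 : A 0 = 0 := rfl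
  have hB0 : B 0 = 0 := rfl
  have hAm : Monotone A := monotone_nat_of_le_succ fun i => by rw [hA1]; omega
  have hBm : Monotone B := monotone_nat_of_le_succ fun i => by rw [hB1]; omega
  have hAB : A m = B n := hab
  refine ⟨fun i j => min (A (i + 1)) (B (j + 1)) - max (A i) (B j), ?_, ?_, ?_⟩
  · intro i i' j j' h hi hj
    have := hAm (show i' + 1 ≤ i from hi)
    have := hBm (show j + 1 ≤ j' from hj)
    dsimp only at h ⊢
    omega
  · intro i hi
    have key : ∀ k, ∑ j ∈ range k, (min (A (i + 1)) (B (j + 1)) - max (A i) (B j)) =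
        min (A (i + 1)) (B k) - min (A i) (B k) := by
      intro k
      induction k with
      | zero => simp [hB0]
      | succ k ih =>
        rw [sum_range_succ, ih]
        have := hA1 i
        have := hB1 k
        omega
    have := hAm (show i + 1 ≤ m from hi)
    have := hA1 i
    rw [key]
    omega
  · intro j hj
    have key : ∀ k, ∑ i ∈ range k, (min (A (i + 1)) (B (j + 1)) - max (A i) (B j)) =
        min (A k) (B (j + 1)) - min (A k) (B j) := by
      intro k
      induction k with
      | zero => simp [hA0]
      | succ k ih =>
        rw [sum_range_succ, ih]
        have := hA1 k
        have := hB1 j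
        omega
    have := hBm (show j + 1 ≤ n from hj)
    have := hB1 j
    rw [key]
    omega

theorem IsStaircase.ext_of_sums {m n : ℕ} {p r : Fin m → Fin n → ℕ} (hp : IsStaircase p)
    (hr : IsStaircase r) (hrow : ∀ i, ∑ j, p i j = ∑ j, r i j)
    (hcol : ∀ j, ∑ i, p i j = ∑ i, r i j) : p = r := by
  set E : (Fin m → Fin n → ℕ) → ℕ → ℕ → ℕ := fun p x y =>
    if h : x < m ∧ y < n then p ⟨x, h.1⟩ ⟨y, h.2⟩ else 0 with hE
  have hEp : ∀ p (i : Fin m) (j : Fin n), E p i j = p i j := fun p i j => by simp [hE]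
  have hst : ∀ p, IsStaircase p → ∀ i i' j j', 0 < E p i j → i' < i → j < j' → E p i' j' = 0 := by
    intro p hp i i' j j' h hi hj
    by_cases h1 : i < m ∧ j < n
    · by_cases h2 : i' < m ∧ j' < n
      · simp only [hE, h1, h2, and_self, dite_true] at h ⊢
        exact hp _ _ _ _ h hi hj
      · simp [hE, h2]
    · simp [hE, h1] at h
  funext i j
  rw [← hEp p, ← hEp r]
  refine staircase_unique (hst p hp) (hst r hr) ?_ ?_ i.2 j.2
  · intro x hx
    have := hrow ⟨x, hx⟩
    simp only [← hEp] at this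
    rw [← Fin.sum_univ_eq_sum_range (fun y => E p x y),
      ← Fin.sum_univ_eq_sum_range (fun y => E r x y)]
    exact this
  · intro y hy
    have := hcol ⟨y, hy⟩
    simp only [← hEp] at this
    rw [← Fin.sum_univ_eq_sum_range (fun x => E p x y),
      ← Fin.sum_univ_eq_sum_range (fun x => E r x y)]
    exact this

theorem exists_isStaircase_of_sums {m n : ℕ} {a : Fin m → ℕ} {b : Fin n → ℕ}
    (hab : ∑ i, a i = ∑ j, b j) :
    ∃ p : Fin m → Fin n → ℕ, IsStaircase p ∧ (∀ i, ∑ j, p i j = a i) ∧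
      ∀ j, ∑ i, p i j = b j := by
  have hext : ∀ k (f : Fin k → ℕ), ∃ g : ℕ → ℕ, ∀ i : Fin k, g i = f i := fun k f =>
    ⟨fun x => if h : x < k then f ⟨x, h⟩ else 0, fun i => by simp⟩
  obtain ⟨a', ha'⟩ := hext m a
  obtain ⟨b', hb'⟩ := hext n b
  simp only [← ha', ← hb'] at hab ⊢
  rw [Fin.sum_univ_eq_sum_range, Fin.sum_univ_eq_sum_range] at hab
  obtain ⟨P, hP, hrow, hcol⟩ := staircase_exists hab
  refine ⟨fun i j => P i j, fun i i' j j' h hi hj => hP i i' j j' h hi hj, fun i => ?_, fun j => ?_⟩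
  · rw [Fin.sum_univ_eq_sum_range (fun y => P i y), hrow i i.2]
  · rw [Fin.sum_univ_eq_sum_range (fun x => P x j), hcol j j.2]

theorem card_piAntidiag_univ {ι : Type*} [Fintype ι] [DecidableEq ι] (N : ℕ) :
    #(piAntidiag (univ : Finset ι) N) = (Fintype.card ι + N - 1).choose N := by
  rw [← map_sym_eq_piAntidiag, card_map, ← Sym.card_sym_eq_choose (α := ι), sym_univ, card_univ]

theorem card_piAntidiag_filter_le {ι : Type*} [Fintype ι] [DecidableEq ι] [Nonempty ι]
    (N q : ℕ) (T : Finset ι) :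
    (#{c ∈ piAntidiag (univ : Finset ι) N | ∀ u ∈ T, q ≤ c u} : ℤ) =
      ichoose ((N : ℤ) - #T * q + Fintype.card ι - 1) (Fintype.card ι - 1) := by
  have hι : 0 < Fintype.card ι := Fintype.card_pos
  rcases le_or_gt (#T * q) N with h | h
  · obtain ⟨M, rfl⟩ := Nat.exists_eq_add_of_le h
    have hsum : ∑ u, (if u ∈ T then q else 0) = #T * q := by simp
    have hcard : #{c ∈ piAntidiag (univ : Finset ι) (#T * q + M) | ∀ u ∈ T, q ≤ c u} =
        #(piAntidiag (univ : Finset ι) M) := by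
      symm
      refine card_bij (fun c _ u => (if u ∈ T then q else 0) + c u) ?_ ?_ ?_
      · intro c hc
        simp only [mem_piAntidiag, mem_univ, implies_true, and_true, mem_filter] at hc ⊢
        rw [sum_add_distrib, hsum, hc]
        refine ⟨rfl, fun u hu => by simp [hu]⟩
      · intro c _ d _ h
        funext u
        exact Nat.add_left_cancel (congrFun h u)
      · intro c hc
        simp only [mem_piAntidiag, mem_univ, implies_true, and_true, mem_filter] at hc
        have hc' : ∀ u, (if u ∈ T then q else 0) + (c u - if u ∈ T then q else 0) = c u := by
          intro u
          split_ifs with hu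
          · have := hc.2 u hu
            omega
          · simp
        refine ⟨fun u => c u - if u ∈ T then q else 0, ?_, funext hc'⟩
        have := hc.1
        simp only [mem_piAntidiag, mem_univ, implies_true, and_true]
        rw [← sum_congr rfl fun u _ => hc' u, sum_add_distrib, hsum] at this
        omega
    rw [hcard, card_piAntidiag_univ, ichoose, if_neg (by push_cast; omega)]
    have h1 : ((((#T * q + M : ℕ) : ℤ) - #T * q + Fintype.card ι - 1)).toNat =
        Fintype.card ι + M - 1 := by
      push_cast; omega
    rw [h1, Nat.choose_symm_of_eq_add]
    omega
  · rw [ichoose, if_pos (by zify at h; push_cast [Nat.cast_sub hι]; omega), Nat.cast_eq_zero,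
      card_eq_zero, filter_eq_empty_iff]
    intro c hc hT
    simp only [mem_piAntidiag, mem_univ, implies_true, and_true] at hc
    have h1 : #T * q ≤ ∑ u ∈ T, c u := by
      simpa using card_nsmul_le_sum T c q hT
    have h2 : ∑ u ∈ T, c u ≤ univ.sum c := sum_le_sum_of_subset (subset_univ T)
    omega

theorem ite_forall_lt_eq_sum_powerset {ι : Type*} (c : ι → ℕ) (q : ℕ) (U : Finset ι) :
    (if ∀ u ∈ U, c u < q then 1 else 0 : ℤ) =
      ∑ T ∈ U.powerset, (-1 : ℤ) ^ #T * if ∀ u ∈ T, q ≤ c u then 1 else 0 := by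
  have h : ∀ u, (if c u < q then 1 else 0 : ℤ) = 1 + -(if q ≤ c u then 1 else 0) := by
    intro u
    by_cases hu : c u < q
    · simp [hu]
    · simp [hu, not_lt.1 hu]
  rw [← prod_boole, prod_congr rfl fun u _ => h u, prod_one_add]
  exact sum_congr rfl fun T _ => by rw [prod_neg, prod_boole]

/-- Inclusion and exclusion for weak compositions whose left parts are small and some right part
is large. -/
theorem card_piAntidiag_filter_sum (m n N q : ℕ) (hm : 0 < m) :
    (#{c ∈ piAntidiag (univ : Finset (Fin m ⊕ Fin n)) N |
        (∀ i, c (Sum.inl i) < q) ∧ ∃ j, q ≤ c (Sum.inr j)} : ℤ) =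
      ∑ i ∈ Icc 1 n, ∑ k ∈ range (m + 1), (-1 : ℤ) ^ (k + i + 1) * n.choose i * m.choose k *
        ichoose ((N : ℤ) - (k + i) * q + (m + n) - 1) (m + n - 1) := by
  have : Nonempty (Fin m ⊕ Fin n) := ⟨Sum.inl ⟨0, hm⟩⟩
  set G : ℕ → ℤ := fun k => ichoose ((N : ℤ) - k * q + (m + n) - 1) (m + n - 1) with hG
  have hT : ∀ (K : Finset (Fin m)) (J : Finset (Fin n)),
      ∑ c ∈ piAntidiag (univ : Finset (Fin m ⊕ Fin n)) N,
        ((if ∀ u ∈ K, q ≤ c (Sum.inl u) then 1 else 0 : ℤ) *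
          if ∀ u ∈ J, q ≤ c (Sum.inr u) then 1 else 0) = G (#K + #J) := by
    intro K J
    have := card_piAntidiag_filter_le N q (K.disjSum J)
    simp only [card_disjSum, Fintype.card_sum, Fintype.card_fin, Nat.cast_add] at this
    rw [hG]
    push_cast
    rw [← this, card_filter, Nat.cast_sum]
    refine sum_congr rfl fun c _ => ?_
    have hiff : (∀ u ∈ K.disjSum J, q ≤ c u) ↔
        (∀ u ∈ K, q ≤ c (Sum.inl u)) ∧ ∀ u ∈ J, q ≤ c (Sum.inr u) := by simp [Sum.forall]
    by_cases h1 : ∀ u ∈ K, q ≤ c (Sum.inl u)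
    · by_cases h2 : ∀ u ∈ J, q ≤ c (Sum.inr u)
      · rw [if_pos h1, if_pos h2, if_pos (hiff.2 ⟨h1, h2⟩)]
        rfl
      · rw [if_neg h2, if_neg fun h => h2 (hiff.1 h).2, mul_zero, Nat.cast_zero]
    · rw [if_neg h1, if_neg fun h => h1 (hiff.1 h).1, zero_mul, Nat.cast_zero]
  have hpow : ∀ (k : ℕ) (f : ℕ → ℤ), ∑ T ∈ (univ : Finset (Fin k)).powerset, (-1 : ℤ) ^ #T * f #T =
      ∑ i ∈ range (k + 1), k.choose i * ((-1 : ℤ) ^ i * f i) := by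
    intro k f
    rw [sum_powerset_apply_card (fun i => (-1 : ℤ) ^ i * f i)]
    simp
  have hl : ∀ c : Fin m ⊕ Fin n → ℕ, (if ∀ i ∈ univ, c (Sum.inl i) < q then 1 else 0 : ℤ) =
      ∑ K ∈ (univ : Finset (Fin m)).powerset,
        (-1 : ℤ) ^ #K * if ∀ u ∈ K, q ≤ c (Sum.inl u) then 1 else 0 := fun c => by
    convert ite_forall_lt_eq_sum_powerset (fun i => c (Sum.inl i)) q univ
  have hr : ∀ c : Fin m ⊕ Fin n → ℕ, (if ∀ j ∈ univ, c (Sum.inr j) < q then 1 else 0 : ℤ) =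
      ∑ J ∈ (univ : Finset (Fin n)).powerset,
        (-1 : ℤ) ^ #J * if ∀ u ∈ J, q ≤ c (Sum.inr u) then 1 else 0 := fun c => by
    convert ite_forall_lt_eq_sum_powerset (fun j => c (Sum.inr j)) q univ
  have hsmall : ∑ c ∈ piAntidiag (univ : Finset (Fin m ⊕ Fin n)) N,
      (if ∀ i ∈ univ, c (Sum.inl i) < q then 1 else 0 : ℤ) =
        ∑ k ∈ range (m + 1), m.choose k * ((-1 : ℤ) ^ k * G k) := by
    simp_rw [hl]
    rw [sum_comm, ← hpow]
    refine sum_congr rfl fun K _ => ?_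
    rw [← mul_sum]
    simpa using hT K ∅
  have hall : ∑ c ∈ piAntidiag (univ : Finset (Fin m ⊕ Fin n)) N,
      ((if ∀ i ∈ univ, c (Sum.inl i) < q then 1 else 0 : ℤ) *
        if ∀ j ∈ univ, c (Sum.inr j) < q then 1 else 0) =
      ∑ i ∈ range (n + 1), n.choose i * ((-1 : ℤ) ^ i *
        ∑ k ∈ range (m + 1), m.choose k * ((-1 : ℤ) ^ k * G (k + i))) := by
    simp_rw [hl, hr, sum_mul_sum]
    rw [← hpow n (fun i => ∑ k ∈ range (m + 1), m.choose k * ((-1 : ℤ) ^ k * G (k + i))), sum_comm]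
    simp_rw [← hpow m (fun k => G (k + _))]
    simp_rw [mul_sum]
    rw [sum_comm (s := (univ : Finset (Fin n)).powerset)]
    refine sum_congr rfl fun K _ => ?_
    rw [sum_comm]
    refine sum_congr rfl fun J _ => ?_
    rw [← hT K J, mul_sum, mul_sum]
    refine sum_congr rfl fun c _ => ?_
    ring
  have hsplit : (#{c ∈ piAntidiag (univ : Finset (Fin m ⊕ Fin n)) N |
        (∀ i, c (Sum.inl i) < q) ∧ ∃ j, q ≤ c (Sum.inr j)} : ℤ) =
      ∑ k ∈ range (m + 1), m.choose k * ((-1 : ℤ) ^ k * G k) -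
        ∑ i ∈ range (n + 1), n.choose i * ((-1 : ℤ) ^ i *
          ∑ k ∈ range (m + 1), m.choose k * ((-1 : ℤ) ^ k * G (k + i))) := by
    rw [← hsmall, ← hall, ← sum_sub_distrib, card_filter, Nat.cast_sum]
    refine sum_congr rfl fun c _ => ?_
    by_cases h1 : ∀ i, c (Sum.inl i) < q <;> by_cases h2 : ∀ j, c (Sum.inr j) < q
    · simp [h1, h2]
    · have h3 : ∃ j, q ≤ c (Sum.inr j) := by simpa using h2
      simp [h1, h2, h3]
    · simp [h1]
    · simp [h1]
  have hrange : range (n + 1) = insert 0 (Icc 1 n) := by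
    ext x
    simp only [mem_range, mem_insert, mem_Icc]
    omega
  rw [hsplit, hrange, sum_insert (by simp)]
  simp only [Nat.choose_zero_right, Nat.cast_one, pow_zero, one_mul, add_zero, sub_add_cancel_left,
    ← sum_neg_distrib]
  refine sum_congr rfl fun i _ => ?_
  rw [← mul_assoc, ← neg_mul, mul_sum]
  refine sum_congr rfl fun k _ => ?_
  simp only [hG]
  push_cast
  ring

theorem ncard_staircase_eq (m n q : ℕ) (hq : 0 < q) :
    Set.ncard {p : Fin m → Fin n → ℕ |
        IsStaircase p ∧ (∀ i : Fin m, ∑ j, p i j ≤ q - 1) ∧ ∃ j : Fin n, q ≤ ∑ i, p i j} =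
      #{c ∈ piAntidiag (univ : Finset (Fin m ⊕ Fin n)) (m * (q - 1)) |
        (∀ i, c (Sum.inl i) < q) ∧ ∃ j, q ≤ c (Sum.inr j)} := by
  rw [← Set.ncard_coe_finset]
  have hsum : ∀ a : Fin m → ℕ, (∀ i, a i ≤ q - 1) →
      ∑ i, (q - 1 - a i) + ∑ i, a i = m * (q - 1) := by
    intro a ha
    rw [← sum_add_distrib, sum_congr rfl fun i _ => Nat.sub_add_cancel (ha i)]
    simp
  refine Set.ncard_congr (fun p _ => Sum.elim (fun i => q - 1 - ∑ j, p i j) fun j => ∑ i, p i j)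
    ?_ ?_ ?_
  · rintro p ⟨-, hrow, hcol⟩
    simp only [coe_filter, mem_piAntidiag, mem_univ, implies_true, and_true, Set.mem_ofPred_eq,
      Fintype.sum_sum_type, Sum.elim_inl, Sum.elim_inr]
    refine ⟨?_, fun i => by omega, hcol⟩
    rw [sum_comm (f := fun j i => p i j)]
    exact hsum _ hrow
  · rintro p r ⟨hp, hprow, -⟩ ⟨hr, hrrow, -⟩ h
    refine hp.ext_of_sums hr (fun i => ?_) fun j => congrFun h (Sum.inr j)
    have := congrFun h (Sum.inl i)
    have := hprow i
    have := hrrow i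
    simp only [Sum.elim_inl] at *
    omega
  · intro c hc
    simp only [coe_filter, mem_piAntidiag, mem_univ, implies_true, and_true, Set.mem_ofPred_eq,
      Fintype.sum_sum_type] at hc
    obtain ⟨hc, hl, hr⟩ := hc
    have := hsum (fun i => c (Sum.inl i)) fun i => by have := hl i; omega
    obtain ⟨p, hp, hrow, hcol⟩ := exists_isStaircase_of_sums
      (a := fun i => q - 1 - c (Sum.inl i)) (b := fun j => c (Sum.inr j)) (by omega)
    refine ⟨p, ⟨hp, fun i => by rw [hrow]; omega, by simpa only [hcol] using hr⟩, ?_⟩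
    funext u
    rcases u with i | j
    · have := hl i
      simp only [Sum.elim_inl, hrow]
      omega
    · simp [hcol]

theorem stmt_6 (m n q : ℕ) (hm : 0 < m) (hn : 0 < n) (hq : 0 < q) :
    ((Set.ncard {p : Fin m → Fin n → ℕ |
        IsStaircase p ∧ (∀ i : Fin m, ∑ j, p i j ≤ q - 1) ∧
          ∃ j : Fin n, q ≤ ∑ i, p i j} : ℕ) : ℤ)
      = ∑ i ∈ Finset.Icc 1 n, ∑ j ∈ Finset.range (m + 1),
          (-1 : ℤ) ^ (m - j + i - 1) * (n.choose i : ℤ) * (m.choose j : ℤ) *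
            ichoose ((j : ℤ) * q - (i : ℤ) * q + n - 1) (m + n - 1) := by
  rw [ncard_staircase_eq m n q hq, card_piAntidiag_filter_sum m n _ q hm]
  refine sum_congr rfl fun i hi => ?_
  rw [← sum_flip]
  refine sum_congr rfl fun j hj => ?_
  have hj' : j ≤ m := by simpa [Nat.lt_succ_iff] using hj
  have hi' : 1 ≤ i := (mem_Icc.1 hi).1
  have hsign : (-1 : ℤ) ^ (m - j + i + 1) = (-1) ^ (m - j + i - 1) := by
    rw [show m - j + i + 1 = m - j + i - 1 + 2 by omega, pow_add]
    simp
  rw [Nat.choose_symm hj', hsign]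
  congr 2
  push_cast [Nat.cast_sub hj', Nat.cast_sub hq]
  ring
end

section
/- For all positive integers $n$ and $q$, $\sum_{i=1}^{n} (-1)^{n-i}\binom{n}{i}\binom{iq + 1}{n+1} = \dfrac{n q^{n+1} - (n-2) q^{n}}{2}$. -/
theorem ichoose_natCast (m b : ℕ) : ichoose (m : ℤ) b = (m.choose b : ℤ) := by
  unfold ichoose
  split_ifs with h
  · rw [Nat.choose_eq_zero_of_lt (by exact_mod_cast h)]
    rfl
  · simp

open Polynomial in
theorem Polynomial.coeff_one_pow_of_commRing {R : Type*} [CommRing R] (g : R[X]) (n : ℕ) :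
    (g ^ n).coeff 1 = n * g.coeff 0 ^ (n - 1) * g.coeff 1 := by
  induction n with
  | zero => simp [coeff_one]
  | succ k ih =>
    rw [pow_succ, mul_coeff_one, ih, coeff_zero_eq_eval_zero (g ^ k), eval_pow,
      ← coeff_zero_eq_eval_zero]
    cases k with
    | zero => simp
    | succ j => push_cast; ring

open Polynomial in
theorem sum_neg_one_pow_mul_choose_mul_choose_eq_coeff (n q r m : ℕ) :
    ∑ i ∈ Finset.range (n + 1), (-1 : ℚ) ^ (n - i) * (n.choose i : ℚ) * ((i * q + r).choose m : ℚ)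
      = ((1 + X : ℚ[X]) ^ r * ((1 + X) ^ q - 1) ^ n).coeff m := by
  rw [sub_eq_add_neg, add_pow ((1 + X) ^ q) (-1), Finset.mul_sum, finsetSum_coeff]
  refine Finset.sum_congr rfl fun i _ => ?_
  have h : (1 + X : ℚ[X]) ^ r * (((1 + X) ^ q) ^ i * (-1) ^ (n - i) * (n.choose i : ℚ[X]))
      = C ((-1 : ℚ) ^ (n - i) * (n.choose i : ℚ)) * (1 + X) ^ (i * q + r) := by
    simp only [map_mul, map_pow, map_neg, map_one, map_natCast]
    ring
  rw [h, coeff_C_mul, coeff_one_add_X_pow]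

open Polynomial in
theorem coeff_succ_one_add_X_mul_pow (n q : ℕ) (hn : 0 < n) :
    ((1 + X : ℚ[X]) ^ 1 * ((1 + X) ^ q - 1) ^ n).coeff (n + 1)
      = ((n : ℚ) * (q : ℚ) ^ (n + 1) - ((n : ℚ) - 2) * (q : ℚ) ^ n) / 2 := by
  set g : ℚ[X] := ((1 + X : ℚ[X]) ^ q).divX with hg
  have hX : (1 + X : ℚ[X]) ^ q - 1 = g * X := by
    have h := divX_mul_X_add ((1 + X : ℚ[X]) ^ q)
    rw [coeff_one_add_X_pow, Nat.choose_zero_right, Nat.cast_one, C_1] at h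
    rw [← h, add_sub_cancel_right]
  have h0 : g.coeff 0 = q := by
    rw [hg, coeff_divX, coeff_one_add_X_pow, zero_add, Nat.choose_one_right]
  have h1 : g.coeff 1 = (q : ℚ) * (q - 1) / 2 := by
    rw [hg, coeff_divX, coeff_one_add_X_pow, Nat.cast_choose_two]
  have hpow : (g ^ n).coeff 0 = (q : ℚ) ^ n := by
    rw [coeff_zero_eq_eval_zero, eval_pow, ← coeff_zero_eq_eval_zero, h0]
  rw [hX, mul_pow, ← mul_assoc, add_comm n 1, coeff_mul_X_pow, pow_one, mul_coeff_one,
    coeff_one_pow_of_commRing, hpow, h0, h1]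
  obtain ⟨k, rfl⟩ := Nat.exists_eq_succ_of_ne_zero hn.ne'
  simp [coeff_one]
  ring

theorem stmt_11 (n q : ℕ) (hn : 0 < n) (hq : 0 < q) :
    (∑ i ∈ Finset.Icc 1 n, (-1 : ℚ) ^ (n - i) * (n.choose i : ℚ) *
        (ichoose ((i : ℤ) * q + 1) (n + 1) : ℚ))
      = ((n : ℚ) * (q : ℚ) ^ (n + 1) - ((n : ℚ) - 2) * (q : ℚ) ^ n) / 2 := by
  rw [← coeff_succ_one_add_X_mul_pow n q hn, ← sum_neg_one_pow_mul_choose_mul_choose_eq_coeff]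
  have hcast (i : ℕ) : (ichoose ((i : ℤ) * q + 1) (n + 1) : ℚ) = ((i * q + 1).choose (n + 1) : ℚ) := by
    have h := ichoose_natCast (i * q + 1) (n + 1)
    push_cast at h
    rw [h, Int.cast_natCast]
  simp only [hcast]
  refine Finset.sum_subset (fun i hi => ?_) fun i hi hi' => ?_
  · simp only [Finset.mem_Icc, Finset.mem_range] at *
    omega
  · have hi0 : i = 0 := by
      simp only [Finset.mem_Icc, Finset.mem_range] at *
      omega
    rw [hi0, Nat.choose_eq_zero_of_lt (show 0 * q + 1 < n + 1 by omega), Nat.cast_zero, mul_zero]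
end

section
/- For all positive integers $n$ and $q$, the number of $(n+1)$-tuples of non-negative integers that sum up to at most $n(q-1)$ and for which the first $n$ entries are all strictly smaller than $q$ equals $\dfrac{n q^{n+1} - (n-2) q^{n}}{2}$. -/
/-- Complementing every digit in base `q` complements the digit sum with respect to
`n * (q - 1)`. -/
lemma sum_val_add_sum_val_rev (n q : ℕ) (w : Fin n → Fin q) :
    ∑ i, (w i : ℕ) + ∑ i, ((w i).rev : ℕ) = n * (q - 1) := by
  rw [← Finset.sum_add_distrib, Finset.sum_congr rfl (g := fun _ => q - 1)]
  · simp
  · intro i _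
    have := (w i).isLt
    rw [Fin.val_rev]
    omega

lemma two_mul_sum_sub_sum_val_add_one (n q : ℕ) :
    2 * ∑ w : Fin n → Fin q, (n * (q - 1) - ∑ i, (w i : ℕ) + 1)
      = q ^ n * (n * (q - 1) + 2) := by
  have hrev : ∑ w : Fin n → Fin q, (n * (q - 1) - ∑ i, ((w i).rev : ℕ) + 1)
      = ∑ w : Fin n → Fin q, (n * (q - 1) - ∑ i, (w i : ℕ) + 1) :=
    Equiv.sum_comp (Equiv.piCongrRight fun _ : Fin n => (Fin.revPerm : Equiv.Perm (Fin q)))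
      (fun w : Fin n → Fin q => n * (q - 1) - ∑ i, (w i : ℕ) + 1)
  rw [two_mul]
  nth_rewrite 2 [← hrev]
  rw [← Finset.sum_add_distrib, Finset.sum_congr rfl (g := fun _ => n * (q - 1) + 2)]
  · simp
  · intro w _
    have := sum_val_add_sum_val_rev n q w
    omega

/-- Counting the tuples by their first `n` entries. -/
lemma ncard_tuples_eq_sum (n q : ℕ) :
    Set.ncard {v : Fin (n + 1) → ℕ |
        (∑ i, v i) ≤ n * (q - 1) ∧ ∀ i : Fin (n + 1), (i : ℕ) < n → v i < q}
      = ∑ w : Fin n → Fin q, (n * (q - 1) - ∑ i, (w i : ℕ) + 1) := by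
  let S : Finset (Σ _ : Fin n → Fin q, ℕ) := Finset.univ.sigma
    fun w => Finset.range (n * (q - 1) - ∑ i, (w i : ℕ) + 1)
  let f : (Σ _ : Fin n → Fin q, ℕ) → Fin (n + 1) → ℕ :=
    fun p => Fin.snoc (α := fun _ => ℕ) (fun i => (p.1 i : ℕ)) p.2
  have hf : Function.Injective f := by
    rintro ⟨w, a⟩ ⟨w', a'⟩ h
    obtain ⟨h₁, h₂⟩ := Fin.snoc_inj.mp h
    obtain rfl : w = w' := funext fun i => Fin.ext (congrFun h₁ i)
    simpa using h₂
  have hS : f '' S = {v : Fin (n + 1) → ℕ |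
      (∑ i, v i) ≤ n * (q - 1) ∧ ∀ i : Fin (n + 1), (i : ℕ) < n → v i < q} := by
    ext v
    constructor
    · rintro ⟨⟨w, a⟩, h, rfl⟩
      have ha : a < n * (q - 1) - ∑ i, (w i : ℕ) + 1 := by simpa [S] using h
      have hw := sum_val_add_sum_val_rev n q w
      refine ⟨?_, fun i hi => ?_⟩
      · simp only [f, Fin.sum_univ_castSucc, Fin.snoc_castSucc, Fin.snoc_last]
        omega
      · obtain ⟨j, rfl⟩ : ∃ j : Fin n, j.castSucc = i := ⟨⟨i, hi⟩, rfl⟩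
        simp [f]
    · rintro ⟨hsum, hlt⟩
      refine ⟨⟨fun i => ⟨v i.castSucc, hlt _ i.isLt⟩, v (Fin.last n)⟩, ?_, ?_⟩
      · rw [Fin.sum_univ_castSucc] at hsum
        simp only [S, Finset.coe_sigma, Set.mem_sigma_iff, Finset.coe_univ, Set.mem_univ,
          true_and, Finset.mem_coe, Finset.mem_range]
        omega
      · exact Fin.snoc_init_self v
  rw [← hS, Set.ncard_image_of_injective _ hf, Set.ncard_coe_finset, Finset.card_sigma]
  simp

theorem stmt_12 (n q : ℕ) (hn : 0 < n) (hq : 0 < q) :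
    ((Set.ncard {v : Fin (n + 1) → ℕ |
        (∑ i, v i) ≤ n * (q - 1) ∧ ∀ i : Fin (n + 1), (i : ℕ) < n → v i < q} : ℕ) : ℚ)
      = ((n : ℚ) * (q : ℚ) ^ (n + 1) - ((n : ℚ) - 2) * (q : ℚ) ^ n) / 2 := by
  rw [ncard_tuples_eq_sum]
  have h := congrArg (Nat.cast : ℕ → ℚ) (two_mul_sum_sub_sum_val_add_one n q)
  rw [Nat.cast_mul, Nat.cast_mul, Nat.cast_add, Nat.cast_mul, Nat.cast_sub hq, Nat.cast_pow] at h
  rw [eq_div_iff two_ne_zero, mul_comm]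
  push_cast at h ⊢
  rw [h]
  ring
end
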